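/- Let N be a continuous real-valued function on the region Ω₁ = {(x,t) : 0 ≤ x ≤ 1, |t − 1/2| ≤ |x − 1/2|}, and for λ ∈ ℂ with λ ≠ 0 define u₁(x,λ) = cos λ(x−1/2) + ∫_{1−x}^{x} N(x,t) cos λ(t−1/2) dt and u₂(x,λ) = sin λ(x−1/2)/λ + ∫_{1−x}^{x} N(x,t) (sin λ(t−1/2))/λ dt. Then for every x ∈ [1/2, 1]: u₁(1−x,λ)u₂(x,λ) − u₁(x,λ)u₂(1−x,λ) = (1/λ) sin λ(2x−1) + (1/λ) ∫₀^{2x−1} [ N(x, t−x+1) − N(1−x, x−t) ] sin λt dt + (1/λ) ∫₀^{2x−1} sin λt · [ ∫₀^{2x−1−t} N(1−x, t−x+τ+1) N(x, τ−x+1) dτ − ∫_t^{2x−1} N(1−x, τ−x+1−t) N(x, τ−x+1) dτ ] dt. -/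

import Mathlib

open MeasureTheory Set

/-- The region `Ω₁ = {(x,t) : 0 ≤ x ≤ 1, |t - 1/2| ≤ |x - 1/2|}`. -/
def Omega1 : Set (ℝ × ℝ) :=
  {p : ℝ × ℝ | 0 ≤ p.1 ∧ p.1 ≤ 1 ∧ |p.2 - 1/2| ≤ |p.1 - 1/2|}

/-- `u₁(x,λ) = cos λ(x-1/2) + ∫_{1-x}^{x} N(x,t) cos λ(t-1/2) dt`. -/
noncomputable def u₁ (N : ℝ → ℝ → ℝ) (l : ℂ) (x : ℝ) : ℂ :=
  Complex.cos (l * ((x : ℂ) - 1/2)) +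
    ∫ t in (1 - x)..x, (N x t : ℂ) * Complex.cos (l * ((t : ℂ) - 1/2))

/-- `u₂(x,λ) = sin λ(x-1/2)/λ + ∫_{1-x}^{x} N(x,t) (sin λ(t-1/2))/λ dt`. -/
noncomputable def u₂ (N : ℝ → ℝ → ℝ) (l : ℂ) (x : ℝ) : ℂ :=
  Complex.sin (l * ((x : ℂ) - 1/2)) / l +
    ∫ t in (1 - x)..x, (N x t : ℂ) * (Complex.sin (l * ((t : ℂ) - 1/2)) / l)

/-- The integral of a cross-correlation of two integrable functions is the product of their
integrals. -/
theorem integral_crossCorrelation {f g : ℝ → ℂ} (hf : Integrable f) (hg : Integrable g) :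
    Integrable (fun t => ∫ τ, f τ * g (t + τ)) ∧
      ∫ t, ∫ τ, f τ * g (t + τ) = (∫ t, f t) * ∫ t, g t := by
  have hconv : (fun t => ∫ τ, f τ * g (t + τ)) =
      convolution (fun τ => f (-τ)) g (ContinuousLinearMap.mul ℝ ℂ) volume := by
    funext t
    rw [convolution_def, ← integral_neg_eq_self]
    simp [sub_eq_add_neg]
  have hconv_integral := integral_convolution (ContinuousLinearMap.mul ℝ ℂ) hf.comp_neg hg
  rw [integral_neg_eq_self f volume] at hconv_integral
  rw [hconv]
  exact ⟨hf.comp_neg.integrable_convolution _ hg, hconv_integral⟩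

/-- Folding the integral over the line onto the positive half-line. -/
theorem integral_eq_integral_Ioi_add_neg {f : ℝ → ℂ} (hf : Integrable f) :
    ∫ t, f t = ∫ t in Ioi 0, (f t + f (-t)) := by
  rw [integral_add hf.integrableOn hf.comp_neg.integrableOn, integral_comp_neg_Ioi, neg_zero,
    add_comm, intervalIntegral.integral_Iic_add_Ioi hf.integrableOn hf.integrableOn]

theorem setIntegral_Icc_eq_intervalIntegral {a b : ℝ} (hab : a ≤ b) (f : ℝ → ℂ) :
    ∫ t in Icc a b, f t = ∫ t in a..b, f t := by
  rw [intervalIntegral.integral_of_le hab, integral_Icc_eq_integral_Ioc]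

/-- Cross-correlation of functions cut off to `[0, L]`, at a nonnegative shift. -/
theorem integral_indicator_mul_indicator_add {L t : ℝ} (ht : 0 ≤ t) (htL : t ≤ L) (F G : ℝ → ℂ) :
    ∫ τ, (Icc 0 L).indicator F τ * (Icc 0 L).indicator G (t + τ) =
      ∫ τ in (0 : ℝ)..(L - t), G (t + τ) * F τ := by
  rw [← setIntegral_Icc_eq_intervalIntegral (by linarith), ← integral_indicator measurableSet_Icc]
  congr 1
  funext τ
  simp only [indicator_apply, mem_Icc]
  split_ifs <;> first | ring1 | (exfalso; grind)

/-- Cross-correlation of functions cut off to `[0, L]`, at a nonpositive shift. -/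
theorem integral_indicator_mul_indicator_sub {L t : ℝ} (ht : 0 ≤ t) (htL : t ≤ L) (F G : ℝ → ℂ) :
    ∫ τ, (Icc 0 L).indicator F τ * (Icc 0 L).indicator G (-t + τ) =
      ∫ τ in t..L, G (τ - t) * F τ := by
  rw [← setIntegral_Icc_eq_intervalIntegral htL, ← integral_indicator measurableSet_Icc]
  congr 1
  funext τ
  simp only [indicator_apply, mem_Icc, neg_add_eq_sub]
  split_ifs <;> first | ring1 | (exfalso; grind)

theorem indicator_mul_indicator_add_eq_zero {L t : ℝ} (ht : L < |t|) (F G : ℝ → ℂ) (τ : ℝ) :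
    (Icc 0 L).indicator F τ * (Icc 0 L).indicator G (t + τ) = 0 := by
  simp only [indicator_apply, mem_Icc]
  rcases lt_abs.1 ht with h | h <;> split_ifs <;> first | ring1 | (exfalso; grind)

/-- A product-to-convolution identity for sine and cosine transforms on `[0, L]`. -/
theorem cos_mul_sin_transform_sub {L : ℝ} (hL : 0 ≤ L) {F G : ℝ → ℂ}
    (hF : ContinuousOn F (Icc 0 L)) (hG : ContinuousOn G (Icc 0 L)) (l : ℂ) :
    (∫ t in (0 : ℝ)..L, F t * Complex.cos (l * t)) * (∫ t in (0 : ℝ)..L, G t * Complex.sin (l * t)) -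
      (∫ t in (0 : ℝ)..L, F t * Complex.sin (l * t)) *
        (∫ t in (0 : ℝ)..L, G t * Complex.cos (l * t)) =
    ∫ t in (0 : ℝ)..L, Complex.sin (l * t) *
      ((∫ τ in (0 : ℝ)..(L - t), G (t + τ) * F τ) - ∫ τ in t..L, G (τ - t) * F τ) := by
  have hcos : Continuous fun t : ℝ => Complex.cos (l * t) := by fun_prop
  have hsin : Continuous fun t : ℝ => Complex.sin (l * t) := by fun_prop
  have integrable_of_cont {f : ℝ → ℂ} (hf : ContinuousOn f (Icc 0 L)) : Integrable ((Icc 0 L).indicator f) :=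
    (integrable_indicator_iff measurableSet_Icc).2 hf.integrableOn_Icc
  have heq (f : ℝ → ℂ) : ∫ t in (0 : ℝ)..L, f t = ∫ t, (Icc 0 L).indicator f t := by
    rw [integral_indicator measurableSet_Icc, setIntegral_Icc_eq_intervalIntegral hL]
  set c : ℝ → ℂ := fun t => Complex.cos (l * t) with hc
  set s : ℝ → ℂ := fun t => Complex.sin (l * t) with hs
  have hFc := integrable_of_cont (hF.mul hcos.continuousOn)
  have hFs := integrable_of_cont (hF.mul hsin.continuousOn)
  have hGc := integrable_of_cont (hG.mul hcos.continuousOn)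
  have hGs := integrable_of_cont (hG.mul hsin.continuousOn)
  obtain ⟨hcs, hcs_integral⟩ := integral_crossCorrelation hFc hGs
  obtain ⟨hsc, hsc_integral⟩ := integral_crossCorrelation hFs hGc
  set H : ℝ → ℂ := fun t => ∫ τ, (Icc 0 L).indicator F τ * (Icc 0 L).indicator G (t + τ) with hH
  have hprod {f g : ℝ → ℂ} (hf : ContinuousOn f (Icc 0 L)) (hg : ContinuousOn g (Icc 0 L))
      (t : ℝ) :
      Integrable fun τ => (Icc 0 L).indicator f τ * (Icc 0 L).indicator g (t + τ) := by
    obtain ⟨C, hC⟩ := isCompact_Icc.exists_bound_of_continuousOn hg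
    refine (integrable_of_cont hf).mul_bdd (c := max C 0) ?_ (.of_forall fun τ => ?_)
    · exact ((integrable_of_cont hg).comp_add_left t).aestronglyMeasurable
    · by_cases h : t + τ ∈ Icc 0 L
      · rw [indicator_of_mem h]
        exact (hC _ h).trans (le_max_left _ _)
      · simp [indicator_of_notMem h]
  have hcorr (t : ℝ) :
      (∫ τ, (Icc 0 L).indicator (F * c) τ * (Icc 0 L).indicator (G * s) (t + τ)) -
        (∫ τ, (Icc 0 L).indicator (F * s) τ * (Icc 0 L).indicator (G * c) (t + τ)) =
      s t * H t := by
    rw [← integral_sub (hprod (hF.mul hcos.continuousOn) (hG.mul hsin.continuousOn) t)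
      (hprod (hF.mul hsin.continuousOn) (hG.mul hcos.continuousOn) t), hH, ← integral_const_mul]
    congr 1
    funext τ
    have hst : s t = s (t + τ) * c τ - c (t + τ) * s τ := by
      simp only [hs, hc]
      rw [← Complex.sin_sub]
      congr 1
      push_cast
      ring
    simp only [indicator_apply, Pi.mul_apply, hst]
    split_ifs <;> ring
  have hsH : Integrable fun t => s t * H t :=
    (hcs.sub hsc).congr (.of_forall hcorr)
  have hfold (t : ℝ) : s t * H t + s (-t) * H (-t) = s t * (H t - H (-t)) := by
    have : s (-t) = -s t := by simp [hs]
    rw [this]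
    ring
  calc
    _ = ∫ t, s t * H t := by
      rw [heq, heq, heq, heq, ← integral_congr_ae (.of_forall hcorr), integral_sub hcs hsc]
      exact congrArg₂ _ hcs_integral.symm hsc_integral.symm
    _ = ∫ t in Ioi 0, s t * (H t - H (-t)) := by
      rw [integral_eq_integral_Ioi_add_neg hsH]
      simp only [hfold]
    _ = ∫ t in Ioc 0 L, s t * (H t - H (-t)) := by
      refine (setIntegral_eq_of_subset_of_forall_sdiff_eq_zero measurableSet_Ioi
        Ioc_subset_Ioi_self fun t ht => ?_)
      have htL : L < |t| := lt_abs.2 (.inl (not_le.1 fun h => ht.2 ⟨ht.1, h⟩))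
      simp only [hH, indicator_mul_indicator_add_eq_zero htL,
        indicator_mul_indicator_add_eq_zero (abs_neg t ▸ htL), integral_zero, sub_zero, mul_zero]
    _ = _ := by
      rw [intervalIntegral.integral_of_le hL]
      refine setIntegral_congr_fun measurableSet_Ioc fun t ht => ?_
      simp only [hH, hs, integral_indicator_mul_indicator_add ht.1.le ht.2,
        integral_indicator_mul_indicator_sub ht.1.le ht.2]

/-- The identity (2.11) of the paper, a consequence of the integral
representations of `u₁` and `u₂` through the kernel `N` alone. -/
theorem u_cross_difference_formula (N : ℝ → ℝ → ℝ)
    (hN : ContinuousOn (fun p : ℝ × ℝ => N p.1 p.2) Omega1)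
    (l : ℂ) (hl : l ≠ 0) :
    ∀ x ∈ Icc (1/2 : ℝ) 1,
      u₁ N l (1 - x) * u₂ N l x - u₁ N l x * u₂ N l (1 - x) =
        (1 / l) * Complex.sin (l * (2 * (x : ℂ) - 1)) +
        (1 / l) * (∫ t in (0:ℝ)..(2 * x - 1),
          ((N x (t - x + 1) - N (1 - x) (x - t) : ℝ) : ℂ) *
            Complex.sin (l * (t : ℂ))) +
        (1 / l) * (∫ t in (0:ℝ)..(2 * x - 1),
          Complex.sin (l * (t : ℂ)) *
            ((∫ τ in (0:ℝ)..(2 * x - 1 - t),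
                ((N (1 - x) (t - x + τ + 1) * N x (τ - x + 1) : ℝ) : ℂ)) -
              ∫ τ in t..(2 * x - 1),
                ((N (1 - x) (τ - x + 1 - t) * N x (τ - x + 1) : ℝ) : ℂ))) := by
  intro x hx
  obtain ⟨hx₁, hx₂⟩ := hx
  have hL : 0 ≤ 2 * x - 1 := by linarith
  set F : ℝ → ℂ := fun τ => (N x (τ - x + 1) : ℂ) with hFdef
  set G : ℝ → ℂ := fun τ => (N (1 - x) (τ - x + 1) : ℂ) with hGdef
  have hF : ContinuousOn F (Icc 0 (2 * x - 1)) := by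
    refine Complex.continuous_ofReal.comp_continuousOn
      (hN.comp (f := fun τ : ℝ => (x, τ - x + 1)) (by fun_prop) fun τ hτ => ?_)
    refine ⟨by linarith, hx₂, ?_⟩
    rw [abs_of_nonneg (by linarith : 0 ≤ x - 1 / 2), abs_le]
    constructor <;> linarith [hτ.1, hτ.2]
  have hG : ContinuousOn G (Icc 0 (2 * x - 1)) := by
    refine Complex.continuous_ofReal.comp_continuousOn
      (hN.comp (f := fun τ : ℝ => (1 - x, τ - x + 1)) (by fun_prop) fun τ hτ => ?_)
    refine ⟨by linarith, by linarith, ?_⟩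
    rw [abs_of_nonpos (by linarith : 1 - x - 1 / 2 ≤ 0), abs_le]
    constructor <;> linarith [hτ.1, hτ.2]
  have integrable_of_cont {f : ℝ → ℂ} (hf : ContinuousOn f (Icc 0 (2 * x - 1))) {g : ℝ → ℂ}
      (hg : Continuous g) : IntervalIntegrable (fun t => f t * g t) volume 0 (2 * x - 1) :=
    (hf.mul hg.continuousOn).intervalIntegrable_of_Icc hL
  have hcos : Continuous fun t : ℝ => Complex.cos (l * t) := by fun_prop
  have hsin : Continuous fun t : ℝ => Complex.sin (l * t) := by fun_prop
  have hlin {f : ℝ → ℂ} (hf : ContinuousOn f (Icc 0 (2 * x - 1))) (p q : ℂ) :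
      ∫ t in (0 : ℝ)..(2 * x - 1),
          f t * (p * Complex.cos (l * t) + q * Complex.sin (l * t)) =
        p * (∫ t in (0 : ℝ)..(2 * x - 1), f t * Complex.cos (l * t)) +
          q * ∫ t in (0 : ℝ)..(2 * x - 1), f t * Complex.sin (l * t) := by
    rw [← intervalIntegral.integral_const_mul, ← intervalIntegral.integral_const_mul,
      ← intervalIntegral.integral_add ((integrable_of_cont hf hcos).const_mul p) ((integrable_of_cont hf hsin).const_mul q)]
    congr 1
    funext t
    ring
  have hshift (f : ℝ → ℂ) :
      ∫ t in (1 - x)..x, f t = ∫ τ in (0 : ℝ)..(2 * x - 1), f (τ - x + 1) := by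
    have := intervalIntegral.integral_comp_add_right (a := 0) (b := 2 * x - 1) f (1 - x)
    rw [zero_add, show 2 * x - 1 + (1 - x) = x by ring] at this
    rw [← this]
    congr 1
    funext τ
    congr 1
    ring
  set a : ℂ := l * ((x : ℂ) - 1 / 2) with ha
  set sa := Complex.sin a with hsa
  set ca := Complex.cos a with hca
  have hphase (τ : ℝ) : l * (((τ - x + 1 : ℝ) : ℂ) - 1 / 2) = l * τ - a := by
    rw [ha]
    push_cast
    ring
  have hcosτ (τ : ℝ) : Complex.cos (l * τ - a) =
      ca * Complex.cos (l * τ) + sa * Complex.sin (l * τ) := by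
    rw [Complex.cos_sub]
    ring
  have hsinτ (τ : ℝ) : Complex.sin (l * τ - a) / l =
      -sa / l * Complex.cos (l * τ) + ca / l * Complex.sin (l * τ) := by
    rw [Complex.sin_sub]
    ring
  have hneg : l * (((1 - x : ℝ) : ℂ) - 1 / 2) = -a := by
    rw [ha]
    push_cast
    ring
  have hdouble : l * (2 * (x : ℂ) - 1) = 2 * a := by
    rw [ha]
    ring
  have h₁ : u₁ N l x = ca + (ca * (∫ t in (0 : ℝ)..(2 * x - 1), F t * Complex.cos (l * t)) +
      sa * ∫ t in (0 : ℝ)..(2 * x - 1), F t * Complex.sin (l * t)) := by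
    rw [u₁, hshift, ← hlin hF]
    simp only [hphase, hcosτ, hFdef, ← ha, ← hca]
  have h₂ : u₂ N l x = sa / l +
      (-sa / l * (∫ t in (0 : ℝ)..(2 * x - 1), F t * Complex.cos (l * t)) +
      ca / l * ∫ t in (0 : ℝ)..(2 * x - 1), F t * Complex.sin (l * t)) := by
    rw [u₂, hshift, ← hlin hF]
    simp only [hphase, hsinτ, hFdef, ← ha, ← hsa]
  have h₁' : u₁ N l (1 - x) =
      ca - (ca * (∫ t in (0 : ℝ)..(2 * x - 1), G t * Complex.cos (l * t)) +
      sa * ∫ t in (0 : ℝ)..(2 * x - 1), G t * Complex.sin (l * t)) := by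
    rw [u₁, sub_sub_cancel, intervalIntegral.integral_symm, hshift, ← hlin hG, hneg,
      Complex.cos_neg, ← sub_eq_add_neg]
    simp only [hphase, hcosτ, hGdef, ← hca]
  have h₂' : u₂ N l (1 - x) = -sa / l -
      (-sa / l * (∫ t in (0 : ℝ)..(2 * x - 1), G t * Complex.cos (l * t)) +
      ca / l * ∫ t in (0 : ℝ)..(2 * x - 1), G t * Complex.sin (l * t)) := by
    rw [u₂, sub_sub_cancel, intervalIntegral.integral_symm, hshift, ← hlin hG, hneg,
      Complex.sin_neg, ← sub_eq_add_neg]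
    simp only [hphase, hsinτ, hGdef, ← hsa]
  have hGrefl_cont : ContinuousOn (fun t : ℝ => (N (1 - x) (x - t) : ℂ)) (Icc 0 (2 * x - 1)) := by
    have := hG.comp (f := fun t : ℝ => 2 * x - 1 - t) (t := Icc 0 (2 * x - 1))
      (s := Icc 0 (2 * x - 1)) (by fun_prop)
      fun t ht => ⟨by linarith [ht.2], by linarith [ht.1]⟩
    refine this.congr fun t _ => ?_
    simp only [hGdef, Function.comp_apply]
    congr 2
    ring
  have hGrefl : ∫ t in (0 : ℝ)..(2 * x - 1), (N (1 - x) (x - t) : ℂ) * Complex.sin (l * t) =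
      Complex.sin (2 * a) * (∫ t in (0 : ℝ)..(2 * x - 1), G t * Complex.cos (l * t)) +
        -Complex.cos (2 * a) * ∫ t in (0 : ℝ)..(2 * x - 1), G t * Complex.sin (l * t) := by
    have := intervalIntegral.integral_comp_sub_left (a := 0) (b := 2 * x - 1)
      (fun t : ℝ => (N (1 - x) (x - t) : ℂ) * Complex.sin (l * t)) (2 * x - 1)
    rw [sub_self, sub_zero] at this
    rw [← this, ← hlin hG]
    congr 1
    funext t
    rw [show x - (2 * x - 1 - t) = t - x + 1 by ring,
      show l * ((2 * x - 1 - t : ℝ) : ℂ) = 2 * a - l * t by rw [← hdouble]; push_cast; ring,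
      Complex.sin_sub]
    simp only [hGdef]
    ring
  have hsingle : ∫ t in (0 : ℝ)..(2 * x - 1),
      ((N x (t - x + 1) - N (1 - x) (x - t) : ℝ) : ℂ) * Complex.sin (l * (t : ℂ)) =
      (∫ t in (0 : ℝ)..(2 * x - 1), F t * Complex.sin (l * t)) -
        ∫ t in (0 : ℝ)..(2 * x - 1), (N (1 - x) (x - t) : ℂ) * Complex.sin (l * t) := by
    rw [← intervalIntegral.integral_sub (integrable_of_cont hF hsin) (integrable_of_cont hGrefl_cont hsin)]
    congr 1
    funext t
    simp only [hFdef]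
    push_cast
    ring
  have hcorr := cos_mul_sin_transform_sub hL hF hG l
  have hadd (t τ : ℝ) : t - x + τ + 1 = t + τ - x + 1 := by ring
  have hsub (t τ : ℝ) : τ - x + 1 - t = τ - t - x + 1 := by ring
  simp only [hadd, hsub, Complex.ofReal_mul]
  rw [hsingle, ← hcorr, h₁, h₂, h₁', h₂', hGrefl, hdouble, Complex.sin_two_mul, Complex.cos_two_mul,
    ← hsa, ← hca]
  have hpyth : sa ^ 2 + ca ^ 2 = 1 := Complex.sin_sq_add_cos_sq a
  generalize (∫ t in (0 : ℝ)..(2 * x - 1), F t * Complex.cos (l * t)) = Fc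
  generalize (∫ t in (0 : ℝ)..(2 * x - 1), F t * Complex.sin (l * t)) = Fs
  generalize (∫ t in (0 : ℝ)..(2 * x - 1), G t * Complex.cos (l * t)) = Gc
  generalize (∫ t in (0 : ℝ)..(2 * x - 1), G t * Complex.sin (l * t)) = Gs
  linear_combination (1 / l) * (Fs - Gs + Fc * Gs - Fs * Gc) * hpyth
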